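/- arXiv:2310.16399 — 2 statements merged into one kernel-verified Lean document; each statement's English description precedes it below -/
import Mathlib

section
/- Let G be a finite abelian group and c ∈ G of order 2. For every Z[G]-module M and every i ≥ 1, Tor_i^{Z[G]}(M, Z[G]₊) ≅ Tor_{i+1}^{Z[G]}(M, Z[G]₋) and Tor_i^{Z[G]}(M, Z[G]₋) ≅ Tor_{i+1}^{Z[G]}(M, Z[G]₊). -/
/-!
Statement 1: For a finite abelian group `G` with `c` of order 2, every `ℤ[G]`-module `M`
and every `i ≥ 1`, `Tor_i(M, ℤ[G]₊) ≅ Tor_{i+1}(M, ℤ[G]₋)` and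
`Tor_i(M, ℤ[G]₋) ≅ Tor_{i+1}(M, ℤ[G]₊)`.
-/

open CategoryTheory

noncomputable section

/-- `ℤ[G]₋ = ℤ[G]/(1+c)` as an object of the category of `ℤ[G]`-modules. -/
def minusPart (G : Type*) [CommGroup G] (c : G) : ModuleCat (MonoidAlgebra ℤ G) :=
  ModuleCat.of (MonoidAlgebra ℤ G)
    (MonoidAlgebra ℤ G ⧸ (Ideal.span {1 + MonoidAlgebra.of ℤ G c} :
      Ideal (MonoidAlgebra ℤ G)))

/-- `ℤ[G]₊ = ℤ[G]/(1-c)` as an object of the category of `ℤ[G]`-modules. -/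
def plusPart (G : Type*) [CommGroup G] (c : G) : ModuleCat (MonoidAlgebra ℤ G) :=
  ModuleCat.of (MonoidAlgebra ℤ G)
    (MonoidAlgebra ℤ G ⧸ (Ideal.span {1 - MonoidAlgebra.of ℤ G c} :
      Ideal (MonoidAlgebra ℤ G)))

section
variable {C : Type*} [Category* C] [Abelian C] {A Z : C}
  {φ ψ : A ⟶ A} (h1 : φ ≫ ψ = 0) (h2 : ψ ≫ φ = 0)

abbrev altCx : ChainComplex C ℕ := HomologicalComplex.alternatingConst A h1 h2
    fun _ _ => ComplexShape.down_nat_odd_add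

def altPi (π : A ⟶ Z) (h3 : ψ ≫ π = 0) : altCx h1 h2 ⟶ (ChainComplex.single₀ C).obj Z :=
  ((altCx h1 h2).toSingle₀Equiv _).symm ⟨π, by simpa using! h3⟩

theorem altPi_zero (π : A ⟶ Z) (h3 : ψ ≫ π = 0) : (altPi h1 h2 π h3).f 0 = π :=
  ChainComplex.toSingle₀Equiv_symm_apply_f_zero _ _

def altRes (e1 : (ShortComplex.mk φ ψ h1).Exact) (e2 : (ShortComplex.mk ψ φ h2).Exact)
    (π : A ⟶ Z) (h3 : ψ ≫ π = 0) (e3 : (ShortComplex.mk ψ π h3).Exact) [Epi π] [Projective A] :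
    ProjectiveResolution Z where
  complex := altCx h1 h2
  projective _ := inferInstanceAs (Projective A)
  π := altPi h1 h2 π h3
  quasiIso := ⟨fun m => by
    cases m with
    | zero =>
      rw [ChainComplex.quasiIsoAt₀_iff, ShortComplex.quasiIso_iff_of_zeros' _ rfl rfl rfl]
      constructor
      · refine (ShortComplex.exact_iff_of_iso ?_).1 e3
        refine ShortComplex.isoMk (Iso.refl _) (Iso.refl _) (Iso.refl _) ?_ ?_
        · simp
          exact (Category.id_comp ψ).trans (Category.comp_id ψ).symm
        · exact (Category.id_comp _).trans
            ((altPi_zero h1 h2 π h3).trans (Category.comp_id π).symm)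
      · have : Epi ((altPi h1 h2 π h3).f 0) := by
          rw [altPi_zero]; exact inferInstanceAs (Epi π)
        exact this
    | succ m =>
      rw [quasiIsoAt_iff_exactAt' (hL := ChainComplex.exactAt_succ_single_obj ..),
          HomologicalComplex.exactAt_iff' _ (m + 2) (m + 1) m (by simp) (by simp)]
      by_cases hm : Odd (m + 1)
      · exact (ShortComplex.exact_iff_of_iso
          (HomologicalComplex.alternatingConstScIsoOdd A h1 h2 _ (by simp) (by simp) hm)).2 e1
      · exact (ShortComplex.exact_iff_of_iso
          (HomologicalComplex.alternatingConstScIsoEven A h1 h2 _ (by simp) (by simp)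
            (Nat.not_odd_iff_even.1 hm))).2 e2⟩

variable {D : Type*} [Category* D] [Abelian D] (F : C ⥤ D) [F.Additive]

def altHomOdd (n : ℕ) (hn : Odd (n + 1)) :
    ((F.mapHomologicalComplex _).obj (altCx h1 h2)).homology (n+1) ≅
      ((ShortComplex.mk φ ψ h1).map F).homology :=
  ShortComplex.homologyMapIso
    ((((F.mapHomologicalComplex _).obj (altCx h1 h2)).isoSc' (n+2) (n+1) n (by simp) (by simp)) ≪≫
     F.mapShortComplex.mapIso
      (HomologicalComplex.alternatingConstScIsoOdd A h1 h2
        (fun _ _ => ComplexShape.down_nat_odd_add) (i := n+2) (k := n) (by simp) (by simp) hn))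

def altHomEven (n : ℕ) (hn : Even (n + 1)) :
    ((F.mapHomologicalComplex _).obj (altCx h1 h2)).homology (n+1) ≅
      ((ShortComplex.mk ψ φ h2).map F).homology :=
  ShortComplex.homologyMapIso
    ((((F.mapHomologicalComplex _).obj (altCx h1 h2)).isoSc' (n+2) (n+1) n (by simp) (by simp)) ≪≫
     F.mapShortComplex.mapIso
      (HomologicalComplex.alternatingConstScIsoEven A h1 h2
        (fun _ _ => ComplexShape.down_nat_odd_add) (i := n+2) (k := n) (by simp) (by simp) hn))

theorem derived_shift [HasProjectiveResolutions C] {Z' : C} [Projective A]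
    (e1 : (ShortComplex.mk φ ψ h1).Exact) (e2 : (ShortComplex.mk ψ φ h2).Exact)
    (π : A ⟶ Z) (h3 : ψ ≫ π = 0) (e3 : (ShortComplex.mk ψ π h3).Exact) [Epi π]
    (π' : A ⟶ Z') (h3' : φ ≫ π' = 0) (e3' : (ShortComplex.mk φ π' h3').Exact) [Epi π']
    (i : ℕ) (hi : 1 ≤ i) :
    Nonempty ((F.leftDerived i).obj Z ≅ (F.leftDerived (i+1)).obj Z') := by
  obtain ⟨n, rfl⟩ : ∃ n, i = n + 1 := ⟨i - 1, by omega⟩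
  let a := (altRes h1 h2 e1 e2 π h3 e3).isoLeftDerivedObj F (n+1)
  let b := (altRes h2 h1 e2 e1 π' h3' e3').isoLeftDerivedObj F (n+1+1)
  by_cases hn : Odd (n + 1)
  · exact ⟨a ≪≫ altHomOdd h1 h2 F n hn ≪≫
      (altHomEven h2 h1 F (n+1) (by grind)).symm ≪≫ b.symm⟩
  · exact ⟨a ≪≫ altHomEven h1 h2 F n (by grind) ≪≫
      (altHomOdd h2 h1 F (n+1) (by grind)).symm ≪≫ b.symm⟩
end

section
variable {R : Type*} [CommRing R]

abbrev mulHom (a : R) : ModuleCat.of R R ⟶ ModuleCat.of R R :=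
  ModuleCat.ofHom (LinearMap.mulLeft R a)

theorem tor_shift_gen (a b : R) (hab : ∀ x, a * x = 0 ↔ b ∣ x) (hba : ∀ x, b * x = 0 ↔ a ∣ x)
    (M : ModuleCat R) (i : ℕ) (hi : 1 ≤ i) :
    Nonempty ((((Tor (ModuleCat R) i).obj M).obj (ModuleCat.of R (R ⧸ Ideal.span {a}))) ≅
      (((Tor (ModuleCat R) (i+1)).obj M).obj (ModuleCat.of R (R ⧸ Ideal.span {b})))) := by
  have hz : a * b = 0 := (hab b).2 dvd_rfl
  have h1 : mulHom b ≫ mulHom a = 0 := by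
    ext; simp [hz]
  have h2 : mulHom a ≫ mulHom b = 0 := by
    ext; simp [mul_comm b a, hz]
  have key : ∀ (a b : R) (h : mulHom b ≫ mulHom a = 0), (∀ x, a * x = 0 ↔ b ∣ x) → 
      (ShortComplex.mk _ _ h).Exact := by
    intro a b h hab
    rw [ShortComplex.moduleCat_exact_iff]
    intro x hx
    obtain ⟨y, hy⟩ := (hab x).1 hx
    exact ⟨y, hy.symm⟩
  have h3 : ∀ a : R, mulHom a ≫ ModuleCat.ofHom (Submodule.mkQ (Ideal.span {a})) = 0 := by
    intro a
    ext
    simp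
  have e3 : ∀ a : R, (ShortComplex.mk _ _ (h3 a)).Exact := by
    intro a
    rw [ShortComplex.moduleCat_exact_iff]
    intro x hx
    obtain ⟨y, hy⟩ := Ideal.mem_span_singleton.1 ((Submodule.Quotient.mk_eq_zero _).1 hx)
    exact ⟨y, hy.symm⟩
  have ep : ∀ a : R, Epi (ModuleCat.ofHom (Submodule.mkQ (Ideal.span {a}))) := fun a =>
    (ModuleCat.epi_iff_surjective _).2 (Submodule.mkQ_surjective _)
  have := ep a
  have := ep b
  exact derived_shift h1 h2 _ (key _ _ _ hab) (key _ _ _ hba) _ _ (e3 a) _ _ (e3 b) i hi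
end

theorem grp_dvd {G : Type*} [CommGroup G] (c : G) (hc : c * c = 1) (hc1 : c ≠ 1)
    (s : ℤ) (hs : s * s = 1) (x : MonoidAlgebra ℤ G) :
    (1 + MonoidAlgebra.single c s) * x = 0 ↔ (1 - MonoidAlgebra.single c s) ∣ x := by
  classical
  constructor
  · intro h
    have hci : c⁻¹ = c := inv_eq_of_mul_eq_one_left hc
    have hx : ∀ g, x.coeff g + s * x.coeff (c * g) = 0 := by
      intro g
      have := congrArg (fun y => MonoidAlgebra.coeff y g) h
      simpa [add_mul, hci] using this
    let _ : LinearOrder G := linearOrderOfSTO WellOrderingRel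
    refine ⟨MonoidAlgebra.ofCoeff (x.coeff.filter (fun g => g < c * g)), ?_⟩
    ext g
    have hg := hx g
    have hne : g ≠ c * g := by simpa using hc1
    have hcg : c * (c * g) = g := by rw [← mul_assoc, hc, one_mul]
    simp only [sub_mul, one_mul, MonoidAlgebra.coeff_sub, Finsupp.sub_apply,
      MonoidAlgebra.coeff_single_mul_apply, hci, Finsupp.filter_apply, hcg]
    rcases lt_or_gt_of_ne hne with h | h
    · simp [h, h.not_gt]
    · simp [h, h.not_gt]
      linarith
  · rintro ⟨y, rfl⟩
    rw [← mul_assoc]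
    have : (1 + MonoidAlgebra.single c s) * (1 - MonoidAlgebra.single c s) = 
      1 - MonoidAlgebra.single c s * MonoidAlgebra.single c s := by ring
    rw [this, MonoidAlgebra.single_mul_single, hc, hs, MonoidAlgebra.one_def, sub_self, zero_mul]

theorem tor_shift_plus_minus
    (G : Type*) [CommGroup G] [Fintype G] (c : G) (hc : c * c = 1) (hc1 : c ≠ 1)
    (M : ModuleCat (MonoidAlgebra ℤ G)) (i : ℕ) (hi : 1 ≤ i) :
    Nonempty ((((Tor (ModuleCat (MonoidAlgebra ℤ G)) i).obj M).obj (plusPart G c)) ≅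
        (((Tor (ModuleCat (MonoidAlgebra ℤ G)) (i + 1)).obj M).obj (minusPart G c))) ∧
    Nonempty ((((Tor (ModuleCat (MonoidAlgebra ℤ G)) i).obj M).obj (minusPart G c)) ≅
        (((Tor (ModuleCat (MonoidAlgebra ℤ G)) (i + 1)).obj M).obj (plusPart G c))) := by
  have hp : (1 + MonoidAlgebra.of ℤ G c) = 1 + MonoidAlgebra.single c 1 := rfl
  have hm : (1 - MonoidAlgebra.of ℤ G c) = 1 - MonoidAlgebra.single c 1 := rfl
  have h1 := grp_dvd c hc hc1 1 (by norm_num)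
  have h2 := grp_dvd c hc hc1 (-1) (by norm_num)
  simp only [MonoidAlgebra.single_neg, ← sub_eq_add_neg, sub_neg_eq_add] at h2
  unfold plusPart minusPart
  rw [hp, hm]
  exact ⟨tor_shift_gen _ _ h2 h1 M i hi, tor_shift_gen _ _ h1 h2 M i hi⟩

end
end

section
/- Let G be a finite abelian group with an element c of order 2, p an odd prime, and write G = G_p × G' with G_p the p-Sylow subgroup. A Z_p[G]₋-module B is projective over Z_p[G]₋ if and only if B is projective as a module over the subring Z_p[G_p] (which embeds in Z_p[G]₋ since p is odd). -/
/-!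
Statement 7: Let `p` be an odd prime, `G = G_p × G'` with `G_p` the `p`-Sylow subgroup and
`c ∈ G'` of order 2 (so `c` lies in the prime-to-`p` part).  A `ℤ_p[G]₋`-module `B` is
projective over `ℤ_p[G]₋` iff it is projective over the subring `ℤ_p[G_p]`, which embeds
into `ℤ_p[G]₋` since `p` is odd.
-/

noncomputable section

def negGroupRing (A : Type*) [CommRing A] (G : Type*) [CommGroup G] (c : G) : Type _ :=
  MonoidAlgebra A G ⧸ (Ideal.span {1 + MonoidAlgebra.of A G c} : Ideal (MonoidAlgebra A G))

instance (A : Type*) [CommRing A] (G : Type*) [CommGroup G] (c : G) :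
    CommRing (negGroupRing A G c) := by unfold negGroupRing; infer_instance

instance (A : Type*) [CommRing A] (G : Type*) [CommGroup G] (c : G) :
    Algebra A (negGroupRing A G c) := by unfold negGroupRing; infer_instance

def negGroupRing.mkOf (A : Type*) [CommRing A] {G : Type*} [CommGroup G] (c : G) (g : G) :
    negGroupRing A G c :=
  Ideal.Quotient.mk _ (MonoidAlgebra.of A G g)


theorem aux_trans {R S B : Type} [CommRing R] [CommRing S] [Algebra R S] [AddCommGroup B]
    [Module R B] [Module S B] [IsScalarTower R S B] (h1 : Module.Projective R S)
    (h2 : Module.Projective S B) : Module.Projective R B := by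
  obtain ⟨s, hs⟩ := Module.projective_def.mp h2
  classical
  haveI : Module.Projective R (B →₀ S) :=
    Module.Projective.of_equiv' (finsuppLequivDFinsupp R (ι := B) (M := S)).symm
  refine Module.Projective.of_split (s.restrictScalars R)
    ((Finsupp.linearCombination S id).restrictScalars R) ?_
  exact LinearMap.ext hs

theorem aux_tower {R S B : Type} [CommRing R] [CommRing S] [AddCommGroup B]
    [Module S B] (f : R →+* S) :
    letI := f.toAlgebra
    letI : Module R B := Module.compHom B f
    IsScalarTower R S B := by
  letI := f.toAlgebra
  letI : Module R B := Module.compHom B f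
  exact ⟨fun r s b => mul_smul (f r) s b⟩

theorem aux_avg {R S B H : Type} [CommRing R] [CommRing S] [Algebra R S] [AddCommGroup B]
    [Module R B] [Module S B] [IsScalarTower R S B] [CommGroup H] [Fintype H]
    (u : H →* S) (hu : Submodule.span R (Set.range u) = ⊤)
    (hH : IsUnit (Fintype.card H : R))
    (h : Module.Projective R B) : Module.Projective S B := by
  let π : (B →₀ S) →ₗ[S] B := Finsupp.linearCombination S id
  have hπ : Function.Surjective π := Finsupp.linearCombination_id_surjective S B
  obtain ⟨s, hs⟩ := Module.projective_lifting_property (π.restrictScalars R) LinearMap.id hπ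
  have hs' : ∀ b, π (s b) = b := fun b => LinearMap.congr_fun hs b
  obtain ⟨v, hv⟩ := hH.exists_left_inv
  let t : B →ₗ[R] (B →₀ S) := v • ∑ x : H,
    (LinearMap.lsmul S (B →₀ S) (u x)).restrictScalars R ∘ₗ s ∘ₗ
      (LinearMap.lsmul S B (u x⁻¹)).restrictScalars R
  have ht : ∀ b, t b = v • ∑ x : H, u x • s (u x⁻¹ • b) := by
    intro b; simp [t, LinearMap.sum_apply]
  have hu1 : ∀ y : H, u y * u y⁻¹ = 1 := fun y => by rw [← map_mul]; simp
  have htu : ∀ (y : H) b, t (u y • b) = u y • t b := by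
    intro y b
    rw [ht, ht, smul_comm (u y) v, Finset.smul_sum (r := u y)]
    refine congrArg (fun z : B →₀ S => v • z)
      (Fintype.sum_equiv (Equiv.mulLeft y⁻¹) _ _ fun x => ?_)
    simp only [Equiv.coe_mulLeft, smul_smul, ← map_mul]
    congr 2
    · simp
    · congr 3; simp
  have htS : ∀ (a : S) b, t (a • b) = a • t b := by
    intro a b
    have ha : a ∈ Submodule.span R (Set.range u) := by rw [hu]; trivial
    induction ha using Submodule.span_induction with
    | mem x hx => obtain ⟨y, rfl⟩ := hx; exact htu y b
    | zero => simp
    | add x y _ _ hx hy => rw [add_smul, map_add, hx, hy, add_smul]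
    | smul r x _ hx => rw [smul_assoc, map_smul, hx, smul_assoc]
  let t' : B →ₗ[S] (B →₀ S) := { toFun := t, map_add' := t.map_add, map_smul' := htS }
  refine Module.Projective.of_split t' π ?_
  ext b
  change π (t b) = b
  have : π (v • ∑ x : H, u x • s (u x⁻¹ • b)) = v • π (∑ x : H, u x • s (u x⁻¹ • b)) :=
    (π.restrictScalars R).map_smul v _
  rw [ht, this, map_sum]
  simp only [map_smul, hs', smul_smul, hu1, one_smul]
  rw [Finset.sum_const, Finset.card_univ, ← Nat.cast_smul_eq_nsmul R, smul_smul, hv, one_smul]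

theorem aux_split {R S T P : Type} [CommRing R] [CommRing S] [CommRing T] [CommRing P]
    [Algebra R S] [Algebra R T] [Module.Projective R T]
    (q : P →+* S) (hq : Function.Surjective q) (j : P →+* T) (k : T →ₐ[R] S)
    (hkj : ∀ x, k (j x) = q x) (e : T) (hke : k e = 1) (he : ∀ x, q x = 0 → e * j x = 0)
    (hR : ∀ r : R, ∃ x, q x = algebraMap R S r ∧ j x = algebraMap R T r) :
    Module.Projective R S := by
  have hwd : ∀ x y, q x = q y → e * j x = e * j y := by
    intro x y h
    have := he (x - y) (by rw [map_sub, h, sub_self])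
    rwa [map_sub, mul_sub, sub_eq_zero] at this
  let i : S → T := fun s => e * j (Function.surjInv hq s)
  have hi : ∀ x, i (q x) = e * j x := fun x => hwd _ _ (Function.surjInv_eq hq _)
  let i' : S →ₗ[R] T :=
    { toFun := i
      map_add' := by
        intro a b
        obtain ⟨x, rfl⟩ := hq a
        obtain ⟨y, rfl⟩ := hq b
        rw [← map_add, hi, hi, hi, map_add, mul_add]
      map_smul' := by
        intro r a
        obtain ⟨x, rfl⟩ := hq a
        obtain ⟨y, h1, h2⟩ := hR r
        rw [Algebra.smul_def, ← h1, ← map_mul, hi, hi, map_mul, RingHom.id_apply,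
          Algebra.smul_def, ← h2]
        ring }
  refine Module.Projective.of_split i' k.toLinearMap ?_
  ext a
  obtain ⟨x, rfl⟩ := hq a
  change k (i (q x)) = q x
  rw [hi, map_mul, hke, one_mul, hkj]

def negMk (A : Type*) [CommRing A] {G : Type*} [CommGroup G] (c : G) :
    MonoidAlgebra A G →ₐ[A] negGroupRing A G c :=
  Ideal.Quotient.mkₐ A (Ideal.span {1 + MonoidAlgebra.of A G c} : Ideal (MonoidAlgebra A G))

theorem negMk_surjective (A : Type*) [CommRing A] {G : Type*} [CommGroup G] (c : G) :
    Function.Surjective (negMk A c) := Ideal.Quotient.mk_surjective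

theorem negMk_eq_zero (A : Type*) [CommRing A] {G : Type*} [CommGroup G] (c : G)
    (x : MonoidAlgebra A G) : negMk A c x = 0 ↔
      x ∈ (Ideal.span {1 + MonoidAlgebra.of A G c} : Ideal (MonoidAlgebra A G)) :=
  Ideal.Quotient.eq_zero_iff_mem

theorem projective_iff_projective_over_p_sylow
    (p : ℕ) [Fact p.Prime] (hp : Odd p)
    (Gp G' : Type) [CommGroup Gp] [Fintype Gp] [CommGroup G'] [Fintype G']
    (hGp : IsPGroup p Gp) (hG' : ¬ p ∣ Fintype.card G')
    (c : G') (hc : c * c = 1) (hc1 : c ≠ 1)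
    (φ : MonoidAlgebra ℤ_[p] Gp →ₐ[ℤ_[p]] negGroupRing ℤ_[p] (Gp × G') (1, c))
    (hφinj : Function.Injective φ)
    (hφ : ∀ g : Gp,
      φ (MonoidAlgebra.of ℤ_[p] Gp g) = negGroupRing.mkOf ℤ_[p] ((1, c) : Gp × G') (g, 1))
    (B : Type) [AddCommGroup B] [Module (negGroupRing ℤ_[p] (Gp × G') (1, c)) B] :
    Module.Projective (negGroupRing ℤ_[p] (Gp × G') (1, c)) B ↔
      (letI : Module (MonoidAlgebra ℤ_[p] Gp) B := Module.compHom B φ.toRingHom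
       Module.Projective (MonoidAlgebra ℤ_[p] Gp) B) := by
  classical
  have h2 : IsUnit (2 : ℤ_[p]) := by
    rw [PadicInt.isUnit_iff]
    have := (PadicInt.norm_natCast_eq_one_iff (p := p) (n := 2)).mpr hp.coprime_two_right
    exact_mod_cast this
  have hcard : IsUnit (Fintype.card G' : ℤ_[p]) := by
    rw [PadicInt.isUnit_iff, PadicInt.norm_natCast_eq_one_iff]
    exact (Fact.out : p.Prime).coprime_iff_not_dvd.mpr hG'
  letI algRS : Algebra (MonoidAlgebra ℤ_[p] Gp) (negGroupRing ℤ_[p] (Gp × G') (1, c)) :=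
    φ.toRingHom.toAlgebra
  letI modRB : Module (MonoidAlgebra ℤ_[p] Gp) B := Module.compHom B φ.toRingHom
  haveI : IsScalarTower (MonoidAlgebra ℤ_[p] Gp) (negGroupRing ℤ_[p] (Gp × G') (1, c)) B :=
    aux_tower φ.toRingHom
  let q := negMk ℤ_[p] ((1, c) : Gp × G')
  have hq : Function.Surjective q := negMk_surjective _ _
  have hmap : ∀ r, algebraMap (MonoidAlgebra ℤ_[p] Gp)
      (negGroupRing ℤ_[p] (Gp × G') (1, c)) r = φ r := fun _ => rfl
  have hφq : ∀ g : Gp, φ (MonoidAlgebra.of ℤ_[p] Gp g) =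
      q (MonoidAlgebra.of ℤ_[p] (Gp × G') (g, 1)) := hφ
  have hqc : q (MonoidAlgebra.of ℤ_[p] (Gp × G') (1, c)) = -1 := by
    have : q (1 + MonoidAlgebra.of ℤ_[p] (Gp × G') (1, c)) = 0 :=
      (negMk_eq_zero _ _ _).mpr (Ideal.subset_span rfl)
    rw [map_add, map_one] at this
    exact (neg_eq_of_add_eq_zero_right this).symm
  let u : G' →* negGroupRing ℤ_[p] (Gp × G') (1, c) :=
    ((q : MonoidAlgebra ℤ_[p] (Gp × G') →* _).comp
      (MonoidAlgebra.of ℤ_[p] (Gp × G'))).comp (MonoidHom.inr Gp G')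
  have huq : ∀ h, u h = q (MonoidAlgebra.of ℤ_[p] (Gp × G') (1, h)) := fun _ => rfl
  have hgh : ∀ (g : Gp) (h : G'), q (MonoidAlgebra.of ℤ_[p] (Gp × G') (g, h)) =
      φ (MonoidAlgebra.of ℤ_[p] Gp g) * u h := by
    intro g h
    rw [hφq, huq, ← map_mul, ← map_mul, Prod.mk_mul_mk, mul_one, one_mul]
  constructor
  · intro hB
    refine aux_trans ?_ hB
    obtain ⟨w, hw⟩ := h2.exists_left_inv
    let j : MonoidAlgebra ℤ_[p] (Gp × G') →ₐ[ℤ_[p]]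
        MonoidAlgebra (MonoidAlgebra ℤ_[p] Gp) G' :=
      MonoidAlgebra.lift ℤ_[p] _ (Gp × G')
        (MonoidHom.coprod
          (((algebraMap (MonoidAlgebra ℤ_[p] Gp)
            (MonoidAlgebra (MonoidAlgebra ℤ_[p] Gp) G') : _ →+* _) : _ →* _).comp
              (MonoidAlgebra.of ℤ_[p] Gp))
          (MonoidAlgebra.of (MonoidAlgebra ℤ_[p] Gp) G'))
    have hj : ∀ g h, j (MonoidAlgebra.of ℤ_[p] (Gp × G') (g, h)) =
        algebraMap (MonoidAlgebra ℤ_[p] Gp) _ (MonoidAlgebra.of ℤ_[p] Gp g) *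
          MonoidAlgebra.of (MonoidAlgebra ℤ_[p] Gp) G' h := by
      intro g h
      simp only [j, MonoidAlgebra.lift_of]
      rfl
    let k : MonoidAlgebra (MonoidAlgebra ℤ_[p] Gp) G' →ₐ[MonoidAlgebra ℤ_[p] Gp]
        negGroupRing ℤ_[p] (Gp × G') (1, c) := MonoidAlgebra.lift _ _ _ u
    have hk : ∀ h, k (MonoidAlgebra.of (MonoidAlgebra ℤ_[p] Gp) G' h) = u h := by
      intro h
      simp only [k, MonoidAlgebra.lift_of]
    have hjA : ∀ a : ℤ_[p], j (algebraMap _ _ a) =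
        algebraMap (MonoidAlgebra ℤ_[p] Gp) _ (algebraMap ℤ_[p] _ a) := by
      intro a
      rw [AlgHom.commutes]
      exact IsScalarTower.algebraMap_apply _ _ _ _
    let w' : MonoidAlgebra ℤ_[p] Gp := algebraMap _ _ w
    have hw' : w' * 2 = 1 := by
      have := congrArg (algebraMap ℤ_[p] (MonoidAlgebra ℤ_[p] Gp)) hw
      rwa [map_mul, map_one, map_ofNat] at this
    refine aux_split q.toRingHom hq j.toRingHom k ?_
      (algebraMap _ _ w' * (1 - MonoidAlgebra.of (MonoidAlgebra ℤ_[p] Gp) G' c)) ?_ ?_ ?_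
    · intro x
      change k (j x) = q x
      induction x using MonoidAlgebra.induction_on with
      | of m =>
        obtain ⟨g, h⟩ := m
        rw [hj, hgh, map_mul, hk, AlgHom.commutes, hmap]
      | add x y hx hy => rw [map_add, map_add, map_add, hx, hy]
      | smul r x hx =>
        rw [Algebra.smul_def, map_mul, map_mul, map_mul, hx, hjA, AlgHom.commutes, hmap,
          AlgHom.commutes, AlgHom.commutes]
    · rw [map_mul, AlgHom.commutes, map_sub, map_one, hk, huq, hqc, sub_neg_eq_add,
        one_add_one_eq_two, ← map_ofNat (algebraMap (MonoidAlgebra ℤ_[p] Gp) _) 2, ← map_mul,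
        hw', map_one]
    · intro x hx
      obtain ⟨y, rfl⟩ := Ideal.mem_span_singleton'.mp ((negMk_eq_zero _ _ _).mp hx)
      change _ * j _ = 0
      rw [map_mul, map_add, map_one, hj, map_one, map_one, one_mul]
      have hcc : MonoidAlgebra.of (MonoidAlgebra ℤ_[p] Gp) G' c *
          MonoidAlgebra.of (MonoidAlgebra ℤ_[p] Gp) G' c = 1 := by
        rw [← map_mul, hc, map_one]
      linear_combination (-(algebraMap _ _ w') * j y) * hcc
    · intro r
      change ∃ x, q x = φ r ∧ j x = _
      induction r using MonoidAlgebra.induction_on with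
      | of g =>
        exact ⟨_, (hφq g).symm, by rw [hj, map_one, mul_one]⟩
      | add x y hx hy =>
        obtain ⟨x', h1, h2⟩ := hx
        obtain ⟨y', h3, h4⟩ := hy
        exact ⟨x' + y', by rw [map_add, map_add, h1, h3], by rw [map_add, map_add, h2, h4]⟩
      | smul a x hx =>
        obtain ⟨x', h1, h2⟩ := hx
        refine ⟨algebraMap _ _ a * x', ?_, ?_⟩
        · rw [map_mul, h1, AlgHom.commutes, map_smul, Algebra.smul_def]
        · rw [map_mul, h2, hjA, Algebra.smul_def, map_mul]
  · intro hB
    refine aux_avg u ?_ ?_ hB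
    · rw [eq_top_iff]
      rintro s -
      obtain ⟨x, rfl⟩ := hq s
      induction x using MonoidAlgebra.induction_on with
      | of m =>
        obtain ⟨g, h⟩ := m
        rw [hgh, ← hmap, ← Algebra.smul_def]
        exact Submodule.smul_mem _ _ (Submodule.subset_span ⟨h, rfl⟩)
      | add x y hx hy => rw [map_add]; exact Submodule.add_mem _ hx hy
      | smul a x hx =>
        have : q (a • x) = (algebraMap ℤ_[p] (MonoidAlgebra ℤ_[p] Gp) a) • q x := by
          rw [Algebra.smul_def, Algebra.smul_def, map_mul, hmap, AlgHom.commutes,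
            AlgHom.commutes]
        rw [this]
        exact Submodule.smul_mem _ _ hx
    · have := hcard.map (algebraMap ℤ_[p] (MonoidAlgebra ℤ_[p] Gp))
      rwa [map_natCast] at this

end
end
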